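/- arXiv:1711.00233 — 5 statements merged into one kernel-verified Lean document; each statement's English description precedes it below -/
import Mathlib

section
/- Each operator L_j is graded symmetric with respect to the super scalar product S: for every j ∈ {1,…,n}, every α ∈ {0,1}, every x ∈ Λ of parity α, and every y ∈ Λ, one has S(L_j x, y) = (−1)^α · S(x, L_j y). -/
/-!
Statement 3: each `L_j` is graded symmetric w.r.t. the super scalar product `S`:
for `x` of parity `α`, `S(L_j x, y) = (−1)^α · S(x, L_j y)`.
-/

noncomputable section

/-- The exterior algebra `Λ` of `ℂⁿ`. -/
abbrev Lam (n : ℕ) : Type := ExteriorAlgebra ℂ (Fin n → ℂ)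

/-- The monomial `e^I = ι(e_{i₁}) * ⋯ * ι(e_{i_k})` for `I = {i₁ < ⋯ < i_k}`. -/
noncomputable def eMon (n : ℕ) (I : Finset (Fin n)) : Lam n :=
  ((I.sort (· ≤ ·)).map fun j => ExteriorAlgebra.ι ℂ (Pi.single j 1)).prod

/-- The interior product (contraction) `∂_j` with the `j`-th coordinate functional. -/
noncomputable def der (n : ℕ) (j : Fin n) : Module.End ℂ (Lam n) :=
  CliffordAlgebra.contractLeft (Q := (0 : QuadraticForm ℂ (Fin n → ℂ)))
    (LinearMap.proj j)

/-- The operator `L_j x = ι(e_j) * x + i • ∂_j x`. -/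
noncomputable def Lop (n : ℕ) (j : Fin n) : Module.End ℂ (Lam n) :=
  LinearMap.mulLeft ℂ (ExteriorAlgebra.ι ℂ (Pi.single j 1)) + Complex.I • der n j

/-- `ε(I,J)` = the number of pairs `(i,j) ∈ I × J` with `j < i`. -/
def eps (n : ℕ) (I J : Finset (Fin n)) : ℕ :=
  ((I ×ˢ J).filter fun p => p.2 < p.1).card

/-- The span of the monomials `e^I` with `|I| ≡ α (mod 2)`: elements of parity `α`. -/
noncomputable def paritySpan (n : ℕ) (α : Fin 2) : Submodule ℂ (Lam n) :=
  Submodule.span ℂ (eMon n '' {I : Finset (Fin n) | I.card % 2 = (α : ℕ)})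

/-- The number of elements of `I` that are smaller than `j`. -/
def countBelow {n : ℕ} (j : Fin n) (I : Finset (Fin n)) : ℕ :=
  (I.filter (· < j)).card

lemma countBelow_add_card_filter_gt {n : ℕ} {j : Fin n} {I : Finset (Fin n)} (hj : j ∉ I) :
    countBelow j I + (I.filter (j < ·)).card = I.card := by
  rw [countBelow, ← Finset.card_filter_add_card_filter_not (s := I) (· < j)]
  congr 2
  refine Finset.filter_congr fun i hi => ?_
  have : i ≠ j := fun h => hj (h ▸ hi)
  rw [not_lt]
  exact ⟨le_of_lt, fun h => lt_of_le_of_ne h this.symm⟩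

lemma eps_eq_sum_countBelow (n : ℕ) (I J : Finset (Fin n)) :
    eps n I J = ∑ i ∈ I, countBelow i J := by
  simp only [eps, countBelow, Finset.card_filter, Finset.sum_product]

lemma eps_insert_left {n : ℕ} {j : Fin n} {I : Finset (Fin n)} (hj : j ∉ I)
    (J : Finset (Fin n)) : eps n (insert j I) J = countBelow j J + eps n I J := by
  simp only [eps_eq_sum_countBelow, Finset.sum_insert hj]

lemma eps_insert_right {n : ℕ} {j : Fin n} {J : Finset (Fin n)} (hj : j ∉ J)
    (I : Finset (Fin n)) :
    eps n I (insert j J) = (I.filter (j < ·)).card + eps n I J := by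
  simp only [eps_eq_sum_countBelow, countBelow, Finset.card_filter, Finset.sum_insert hj,
    Finset.sum_add_distrib]

/-- Moving the index `j` from the left block to the right block of a pair of complementary
monomials. -/
lemma neg_one_pow_eps_insert {n : ℕ} {j : Fin n} {I J : Finset (Fin n)}
    (hI : j ∉ I) (hJ : j ∉ J) :
    (-1 : ℂ) ^ countBelow j I * (-1) ^ eps n (insert j I) J =
      (-1) ^ I.card * ((-1) ^ countBelow j J * (-1) ^ eps n I (insert j J)) := by
  rw [eps_insert_left hI, eps_insert_right hJ, ← countBelow_add_card_filter_gt hI]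
  simp only [pow_add]
  have h : ((-1 : ℂ) ^ (I.filter (j < ·)).card) * (-1) ^ (I.filter (j < ·)).card = 1 := by
    rw [← mul_pow]; simp
  linear_combination (-(-1 : ℂ) ^ countBelow j I * (-1) ^ countBelow j J * (-1) ^ eps n I J) * h

lemma eMon_insert_of_lt {n : ℕ} {m : Fin n} {I : Finset (Fin n)} (h : ∀ i ∈ I, m < i) :
    eMon n (insert m I) = ExteriorAlgebra.ι ℂ (Pi.single m 1) * eMon n I := by
  have hm : m ∉ I := fun hm => lt_irrefl m (h m hm)
  rw [eMon, Finset.sort_insert (· ≤ ·) (fun i hi => (h i hi).le) hm, List.map_cons, List.prod_cons, eMon]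

lemma ι_mul_ι_swap {n : ℕ} (v w : Fin n → ℂ) :
    ExteriorAlgebra.ι ℂ v * ExteriorAlgebra.ι ℂ w =
      -(ExteriorAlgebra.ι ℂ w * ExteriorAlgebra.ι ℂ v) :=
  eq_neg_of_add_eq_zero_left (ExteriorAlgebra.ι_add_mul_swap v w)

lemma ι_mul_eMon {n : ℕ} (j : Fin n) (I : Finset (Fin n)) :
    ExteriorAlgebra.ι ℂ (Pi.single j 1) * eMon n I =
      if j ∈ I then 0 else (-1 : ℂ) ^ countBelow j I • eMon n (insert j I) := by
  induction I using Finset.induction_on_min with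
  | empty => simpa [countBelow] using (eMon_insert_of_lt (m := j) (I := ∅) (by simp)).symm
  | insert m K hm ih =>
    rcases lt_trichotomy j m with hj | rfl | hj
    · have hlt : ∀ i ∈ insert m K, j < i := by
        simpa using ⟨hj, fun i hi => hj.trans (hm i hi)⟩
      have hc : countBelow j (insert m K) = 0 := by
        simpa [countBelow, Finset.filter_eq_empty_iff] using
          ⟨hj.le, fun i hi => (hj.trans (hm i hi)).le⟩
      rw [if_neg fun h => lt_irrefl j (hlt j h), hc, pow_zero, one_smul, eMon_insert_of_lt hlt]
    · rw [eMon_insert_of_lt hm, ← mul_assoc, ExteriorAlgebra.ι_sq_zero, zero_mul,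
        if_pos (Finset.mem_insert_self _ _)]
    · have hmK : m ∉ K := fun h => lt_irrefl m (hm m h)
      rw [eMon_insert_of_lt hm, ← mul_assoc, ι_mul_ι_swap, neg_mul, mul_assoc, ih]
      by_cases hjK : j ∈ K
      · simp [hjK]
      · have hlt : ∀ i ∈ insert j K, m < i := by simpa using ⟨hj, hm⟩
        have hc : countBelow j (insert m K) = countBelow j K + 1 := by
          simp [countBelow, Finset.filter_insert, hj, hmK]
        rw [if_neg hjK, if_neg (by simp [hj.ne', hjK]), hc, Finset.insert_comm,
          eMon_insert_of_lt hlt, mul_smul_comm, pow_succ, mul_neg_one, neg_smul]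

lemma der_ι_mul {n : ℕ} (j k : Fin n) (x : Lam n) :
    der n j (ExteriorAlgebra.ι ℂ (Pi.single k 1) * x) =
      (Pi.single k (1 : ℂ) : Fin n → ℂ) j • x -
        ExteriorAlgebra.ι ℂ (Pi.single k 1) * der n j x :=
  CliffordAlgebra.contractLeft_ι_mul (Q := (0 : QuadraticForm ℂ (Fin n → ℂ))) _ _ x

lemma der_eMon_of_notMem {n : ℕ} {j : Fin n} {I : Finset (Fin n)} (hj : j ∉ I) :
    der n j (eMon n I) = 0 := by
  induction I using Finset.induction_on_min with
  | empty =>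
    rw [eMon, Finset.sort_empty, List.map_nil, List.prod_nil]
    exact CliffordAlgebra.contractLeft_one (Q := (0 : QuadraticForm ℂ (Fin n → ℂ))) _
  | insert m K hm ih =>
    rw [Finset.mem_insert, not_or] at hj
    rw [eMon_insert_of_lt hm, der_ι_mul, ih hj.2, Pi.single_eq_of_ne hj.1, zero_smul, mul_zero,
      sub_zero]

lemma der_eMon_insert {n : ℕ} {j : Fin n} {I : Finset (Fin n)} (hj : j ∉ I) :
    der n j (eMon n (insert j I)) = (-1 : ℂ) ^ countBelow j I • eMon n I := by
  have h := congrArg (der n j) (ι_mul_eMon j I)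
  rw [if_neg hj, der_ι_mul, der_eMon_of_notMem hj, Pi.single_eq_same, one_smul, mul_zero,
    sub_zero, map_smul] at h
  rw [h, smul_smul, ← mul_pow, neg_one_mul, neg_neg, one_pow, one_smul]

lemma span_range_eMon (n : ℕ) : Submodule.span ℂ (Set.range (eMon n)) = ⊤ := by
  have hmul : ∀ (v : Fin n → ℂ) (y : Lam n), y ∈ Submodule.span ℂ (Set.range (eMon n)) →
      ExteriorAlgebra.ι ℂ v * y ∈ Submodule.span ℂ (Set.range (eMon n)) := by
    intro v y hy
    rw [pi_eq_sum_univ' v, map_sum, Finset.sum_mul]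
    refine Submodule.sum_mem _ fun j _ => ?_
    rw [map_smul, smul_mul_assoc]
    refine Submodule.smul_mem _ _ ?_
    induction hy using Submodule.span_induction with
    | mem y hy =>
      obtain ⟨I, rfl⟩ := hy
      rw [ι_mul_eMon]
      split_ifs
      · exact Submodule.zero_mem _
      · exact Submodule.smul_mem _ _ (Submodule.subset_span ⟨_, rfl⟩)
    | zero => simp
    | add a b _ _ ha hb => rw [mul_add]; exact Submodule.add_mem _ ha hb
    | smul c a _ ha => rw [mul_smul_comm]; exact Submodule.smul_mem _ _ ha
  refine Submodule.eq_top_iff'.2 fun x => ?_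
  induction x using CliffordAlgebra.left_induction with
  | algebraMap r =>
    rw [Algebra.algebraMap_eq_smul_one]
    exact Submodule.smul_mem _ _ (Submodule.subset_span ⟨∅, by simp [eMon]⟩)
  | add a b ha hb => exact Submodule.add_mem _ ha hb
  | ι_mul x v hx => exact hmul v x hx

/-- Multiplication by `e_j` is graded symmetric on monomials. -/
lemma ι_mul_graded_symmetric_eMon {n : ℕ} {S : Lam n →ₗ⋆[ℂ] Lam n →ₗ[ℂ] ℂ}
    (hS : ∀ I J : Finset (Fin n),
      S (eMon n I) (eMon n J) = if J = Iᶜ then (-1 : ℂ) ^ eps n I Iᶜ else 0)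
    (j : Fin n) (I J : Finset (Fin n)) :
    S (ExteriorAlgebra.ι ℂ (Pi.single j 1) * eMon n I) (eMon n J) =
      (-1 : ℂ) ^ I.card *
        S (eMon n I) (ExteriorAlgebra.ι ℂ (Pi.single j 1) * eMon n J) := by
  rw [ι_mul_eMon, ι_mul_eMon]
  by_cases hI : j ∈ I
  · by_cases hJ : j ∈ J
    · simp [hI, hJ]
    · have h : insert j J ≠ Iᶜ := fun h =>
        Finset.mem_compl.1 (h ▸ Finset.mem_insert_self j J) hI
      simp [hI, hJ, hS, h]
  · by_cases hJ : j ∈ J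
    · have h : J ≠ (insert j I)ᶜ := fun h => by simp [h] at hJ
      rw [if_neg hI, if_pos hJ, map_smulₛₗ, LinearMap.smul_apply, hS, if_neg h]
      simp
    · have hiff : J = (insert j I)ᶜ ↔ insert j J = Iᶜ := by
        simp only [Finset.ext_iff, Finset.mem_insert, Finset.mem_compl]
        refine forall_congr' fun a => ?_
        by_cases ha : a = j
        · subst ha; simp [hI, hJ]
        · simp [ha]
      have key := neg_one_pow_eps_insert hI hJ
      rw [if_neg hI, if_neg hJ]
      simp only [map_smulₛₗ, LinearMap.smul_apply, smul_eq_mul, map_pow, map_neg, map_one,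
        hS]
      by_cases h : J = (insert j I)ᶜ
      · rwa [if_pos h, if_pos (hiff.1 h), ← h, ← hiff.1 h]
      · rw [if_neg h, if_neg (mt hiff.2 h)]
        simp

/-- Contraction with the `j`-th coordinate is graded antisymmetric on monomials. -/
lemma der_graded_antisymmetric_eMon {n : ℕ} {S : Lam n →ₗ⋆[ℂ] Lam n →ₗ[ℂ] ℂ}
    (hS : ∀ I J : Finset (Fin n),
      S (eMon n I) (eMon n J) = if J = Iᶜ then (-1 : ℂ) ^ eps n I Iᶜ else 0)
    (j : Fin n) (I J : Finset (Fin n)) :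
    S (der n j (eMon n I)) (eMon n J) =
      -((-1 : ℂ) ^ I.card * S (eMon n I) (der n j (eMon n J))) := by
  by_cases hI : j ∈ I
  · obtain ⟨K, hK, rfl⟩ : ∃ K, j ∉ K ∧ insert j K = I :=
      ⟨I.erase j, Finset.notMem_erase j I, Finset.insert_erase hI⟩
    rw [der_eMon_insert hK]
    by_cases hJ : j ∈ J
    · obtain ⟨M, hM, rfl⟩ : ∃ M, j ∉ M ∧ insert j M = J :=
        ⟨J.erase j, Finset.notMem_erase j J, Finset.insert_erase hJ⟩
      have key := ι_mul_graded_symmetric_eMon hS j K M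
      rw [ι_mul_eMon, ι_mul_eMon, if_neg hK, if_neg hM] at key
      have hs : ∀ k : ℕ, (-1 : ℂ) ^ k * (-1) ^ k = 1 := fun k => by rw [← mul_pow]; simp
      rw [der_eMon_insert hM, Finset.card_insert_of_notMem hK]
      simp only [map_smulₛₗ, LinearMap.smul_apply, smul_eq_mul, map_pow, map_neg, map_one,
        pow_succ] at key ⊢
      linear_combination
        (-(-1 : ℂ) ^ countBelow j K * (-1) ^ K.card * (-1) ^ countBelow j M) * key
          - (-1 : ℂ) ^ countBelow j K * S (eMon n K) (eMon n (insert j M)) *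
            ((-1) ^ countBelow j M * (-1) ^ countBelow j M * hs K.card + hs (countBelow j M))
          + (-1 : ℂ) ^ K.card * (-1) ^ countBelow j M * S (eMon n (insert j K)) (eMon n M) *
            hs (countBelow j K)
    · have h : J ≠ Kᶜ := fun h => by simp [h, hK] at hJ
      simp [der_eMon_of_notMem hJ, hS, h]
  · rw [der_eMon_of_notMem hI]
    by_cases hJ : j ∈ J
    · obtain ⟨M, hM, rfl⟩ : ∃ M, j ∉ M ∧ insert j M = J :=
        ⟨J.erase j, Finset.notMem_erase j J, Finset.insert_erase hJ⟩
      have h : M ≠ Iᶜ := fun h => by simp [h, hI] at hM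
      simp [der_eMon_insert hM, hS, h]
    · simp [der_eMon_of_notMem hJ]

theorem Lop_graded_symmetric (n : ℕ)
    (S : Lam n →ₗ⋆[ℂ] Lam n →ₗ[ℂ] ℂ)
    (hS : ∀ I J : Finset (Fin n),
      S (eMon n I) (eMon n J) = if J = Iᶜ then (-1 : ℂ) ^ eps n I Iᶜ else 0)
    (j : Fin n) (α : Fin 2) (x : Lam n) (hx : x ∈ paritySpan n α) (y : Lam n) :
    S (Lop n j x) y = (-1 : ℂ) ^ (α : ℕ) * S x (Lop n j y) := by
  have hy : y ∈ Submodule.span ℂ (Set.range (eMon n)) := span_range_eMon n ▸ Submodule.mem_top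
  induction hx using Submodule.span_induction with
  | zero => simp
  | add a b _ _ ha hb => simp only [map_add, LinearMap.add_apply, ha, hb, mul_add]
  | smul c a _ ha =>
    simp only [map_smul, map_smulₛₗ, LinearMap.smul_apply, ha, smul_eq_mul]
    ring
  | mem x hx =>
    obtain ⟨I, hI, rfl⟩ := hx
    have hα : (-1 : ℂ) ^ (α : ℕ) = (-1) ^ I.card := by
      rw [← (hI : I.card % 2 = (α : ℕ)), ← neg_one_pow_eq_pow_mod_two]
    rw [hα]
    induction hy using Submodule.span_induction with
    | zero => simp
    | add a b _ _ ha hb => simp only [map_add, ha, hb, mul_add]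
    | smul c a _ ha =>
      simp only [map_smul, ha, smul_eq_mul]
      ring
    | mem y hy =>
      obtain ⟨J, rfl⟩ := hy
      simp only [Lop, LinearMap.add_apply, LinearMap.smul_apply, LinearMap.mulLeft_apply, map_add,
        map_smul, map_smulₛₗ, smul_eq_mul, ι_mul_graded_symmetric_eMon hS,
        der_graded_antisymmetric_eMon hS, Complex.conj_I]
      ring

end
end

section
/- Let n ∈ ℕ and let T : Finset (Fin n) → Finset (Fin n) → ℝ be a real matrix indexed by the subsets of an n-element set. Assume (a) T I J = 0 whenever I ∩ J ≠ ∅, and (b) T Iᶜ I ≠ 0 for every subset I. Then T is invertible as a 2ⁿ × 2ⁿ real matrix; equivalently, if c : Finset (Fin n) → ℝ satisfies Σ_J T I J · c J = 0 for every I, then c = 0. -/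
/-!
Statement 5: a real matrix `T` indexed by subsets of `{1,…,n}` with `T I J = 0`
whenever `I ∩ J ≠ ∅` and `T Iᶜ I ≠ 0` for all `I` is invertible; equivalently the
associated linear map has trivial kernel.
-/

open scoped BigOperators

/-- A matrix indexed by finsets that vanishes at intersecting pairs and is nonzero at complementary
pairs has trivial kernel. -/
theorem eq_zero_of_forall_sum_mul_eq_zero {α R : Type*} [Fintype α] [DecidableEq α]
    [Semiring R] [NoZeroDivisors R] {T : Finset α → Finset α → R}
    (hzero : ∀ I J : Finset α, I ∩ J ≠ ∅ → T I J = 0)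
    (hdiag : ∀ I : Finset α, T Iᶜ I ≠ 0) {c : Finset α → R}
    (hc : ∀ I : Finset α, ∑ J : Finset α, T I J * c J = 0) : c = 0 := by
  funext K
  induction K using Finset.strongInduction with
  | H K ih =>
    have h := hc Kᶜ
    rw [Finset.sum_eq_single K] at h
    · exact (mul_eq_zero.mp h).resolve_left (hdiag K)
    · intro J _ hJK
      by_cases hsub : J ⊆ K
      · rw [ih J (hsub.ssubset_of_ne hJK), Pi.zero_apply, mul_zero]
      · obtain ⟨x, hxJ, hxK⟩ := Finset.not_subset.mp hsub
        have hne : Kᶜ ∩ J ≠ ∅ :=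
          Finset.ne_empty_of_mem (Finset.mem_inter.mpr ⟨Finset.mem_compl.mpr hxK, hxJ⟩)
        rw [hzero _ _ hne, zero_mul]
    · simp

theorem subset_matrix_invertible (n : ℕ)
    (T : Finset (Fin n) → Finset (Fin n) → ℝ)
    (hzero : ∀ I J : Finset (Fin n), I ∩ J ≠ ∅ → T I J = 0)
    (hdiag : ∀ I : Finset (Fin n), T Iᶜ I ≠ 0) :
    IsUnit (Matrix.of T : Matrix (Finset (Fin n)) (Finset (Fin n)) ℝ) ∧
      ∀ c : Finset (Fin n) → ℝ,
        (∀ I : Finset (Fin n), ∑ J : Finset (Fin n), T I J * c J = 0) → c = 0 := by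
  have hker : ∀ c : Finset (Fin n) → ℝ,
      (∀ I : Finset (Fin n), ∑ J : Finset (Fin n), T I J * c J = 0) → c = 0 :=
    fun _ hc => eq_zero_of_forall_sum_mul_eq_zero hzero hdiag hc
  refine ⟨Matrix.mulVec_injective_iff_isUnit.mp ?_, hker⟩
  rw [← Matrix.coe_mulVecLin, injective_iff_map_eq_zero]
  exact fun c hc => hker c fun I => congrFun hc I
end

section
/- Hadamard factorization implies smoothness: let O ⊆ ℝ^m be an open set, F a real Banach space, k ∈ ℕ, f : ℝ^m → F a function, and g_1, …, g_m : ℝ^m × ℝ^m → F functions of class C^k on O × O such that f(x) − f(y) = Σ_{i=1}^m (x_i − y_i) • g_i(x,y) for all x, y ∈ O. Then f is of class C^{k+1} on O, and its partial derivatives are given on the diagonal by (∂_i f)(x) = g_i(x,x) for every x ∈ O and every i. -/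
/-!
Statement 12: a Hadamard factorization with `C^k` factors implies that `f` is `C^{k+1}`
on the open set `O`, with partial derivatives given on the diagonal by the factors.
-/

open scoped BigOperators

/-- A function that vanishes at `x` and is differentiable there, multiplied by a function merely
continuous at `x`, is differentiable at `x`. -/
theorem HasFDerivAt.smul_continuousAt_of_eq_zero {E F : Type*} [NormedAddCommGroup E]
    [NormedSpace ℝ E] [NormedAddCommGroup F] [NormedSpace ℝ F] {c : E → ℝ} {c' : E →L[ℝ] ℝ}
    {h : E → F} {x : E} (hc : HasFDerivAt c c' x) (hx : c x = 0) (hh : ContinuousAt h x) :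
    HasFDerivAt (fun y => c y • h y) (c'.smulRight (h x)) x := by
  have hsub : (fun y => h y - h x) =o[nhds x] (fun _ => (1 : ℝ)) := by
    rw [Asymptotics.isLittleO_one_iff]
    simpa using hh.sub_const (h x)
  have hrem : HasFDerivAt (fun y => c y • (h y - h x)) (0 : E →L[ℝ] F) x := by
    rw [hasFDerivAt_iff_isLittleO]
    have hO : c =O[nhds x] (fun y => y - x) := by
      simpa [hx] using hc.isBigO_sub
    simpa [hx] using hO.norm_right.smul_isLittleO hsub
  convert (hc.smul_const (h x)).add hrem using 1
  · ext y
    simp [smul_sub]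
  · simp

theorem hadamard_factorization_implies_smoothness
    {m : ℕ} {F : Type*} [NormedAddCommGroup F] [NormedSpace ℝ F] [CompleteSpace F]
    (O : Set (Fin m → ℝ)) (hO : IsOpen O) (k : ℕ)
    (f : (Fin m → ℝ) → F)
    (g : Fin m → ((Fin m → ℝ) × (Fin m → ℝ)) → F)
    (hg : ∀ i : Fin m, ContDiffOn ℝ k (g i) (O ×ˢ O))
    (hfact : ∀ x ∈ O, ∀ y ∈ O,
      f x - f y = ∑ i : Fin m, (x i - y i) • g i (x, y)) :
    ContDiffOn ℝ (k + 1) f O ∧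
      ∀ x ∈ O, ∀ i : Fin m, fderiv ℝ f x (Pi.single i 1) = g i (x, x) := by
  have hdiag : ContDiffOn ℝ k (fun x : Fin m → ℝ => (x, x)) O := by fun_prop
  have hderiv : ∀ x ∈ O, HasFDerivAt f
      (∑ i, (ContinuousLinearMap.proj (R := ℝ) (φ := fun _ : Fin m => ℝ) i).smulRight
        (g i (x, x))) x := by
    intro x hx
    have hterm : ∀ i, HasFDerivAt (fun y : Fin m → ℝ => (y i - x i) • g i (y, x))
        ((ContinuousLinearMap.proj (R := ℝ) (φ := fun _ : Fin m => ℝ) i).smulRight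
          (g i (x, x))) x := by
      intro i
      refine HasFDerivAt.smul_continuousAt_of_eq_zero (h := fun y => g i (y, x))
        ((hasFDerivAt_apply i x).sub_const (x i)) (sub_self _) ?_
      have hgc : ContinuousAt (g i) (x, x) :=
        (hg i).continuousOn.continuousAt ((hO.prod hO).mem_nhds ⟨hx, hx⟩)
      exact ContinuousAt.comp (f := fun y => (y, x)) hgc (by fun_prop)
    have hsum := (HasFDerivAt.fun_sum (u := Finset.univ) fun i _ => hterm i).const_add (f x)
    refine hsum.congr_of_eventuallyEq ?_
    filter_upwards [hO.mem_nhds hx] with y hy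
    rw [← hfact y hy x hx, add_sub_cancel]
  refine ⟨?_, fun x hx i => ?_⟩
  · rw [contDiffOn_succ_iff_hasFDerivWithinAt_of_uniqueDiffOn hO.uniqueDiffOn]
    refine ⟨by simp, _, ?_, fun x hx => (hderiv x hx).hasFDerivWithinAt⟩
    refine ContDiffOn.sum fun i _ => contDiffOn_const.smulRight ?_
    exact (hg i).comp hdiag fun x hx => ⟨hx, hx⟩
  · rw [(hderiv x hx).fderiv]
    simp [Pi.single_apply]
end

section
/- Let V be an infinite-dimensional real vector space and let x be an element of the exterior algebra ⋀V = ExteriorAlgebra ℝ V. If x * ι(v) = 0 for every v ∈ V (where ι : V → ⋀V is the canonical inclusion and * is the exterior-algebra product), then x = 0. (This is the cancellation property of the ring 𝒜 = ⋀V used to deduce identities from equations valid for all odd parameters.) -/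
open CliffordAlgebra in
/-- Right contraction of a given element by a functional vanishes as soon as the functional
vanishes on a suitable finitely generated submodule. -/
theorem CliffordAlgebra.exists_fg_forall_contractRight_eq_zero
    {R M : Type*} [CommRing R] [AddCommGroup M] [Module R M] {Q : QuadraticForm R M}
    (x : CliffordAlgebra Q) :
    ∃ W : Submodule R M, W.FG ∧ ∀ d : Module.Dual R M, (∀ w ∈ W, d w = 0) →
      contractRight x d = 0 := by
  induction x using CliffordAlgebra.right_induction with
  | algebraMap r => exact ⟨⊥, Submodule.fg_bot, fun d _ => contractRight_algebraMap Q d r⟩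
  | add x y hx hy =>
    obtain ⟨W₁, h₁, hx⟩ := hx
    obtain ⟨W₂, h₂, hy⟩ := hy
    refine ⟨W₁ ⊔ W₂, h₁.sup h₂, fun d hd => ?_⟩
    rw [map_add, LinearMap.add_apply, hx d fun w hw => hd w (Submodule.mem_sup_left hw),
      hy d fun w hw => hd w (Submodule.mem_sup_right hw), add_zero]
  | mul_ι m x hx =>
    obtain ⟨W, hW, hx⟩ := hx
    refine ⟨W ⊔ Submodule.span R {m}, hW.sup (Submodule.fg_span_singleton m), fun d hd => ?_⟩
    rw [contractRight_mul_ι, hx d fun w hw => hd w (Submodule.mem_sup_left hw),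
      hd m (Submodule.mem_sup_right (Submodule.mem_span_singleton_self m)), zero_smul, zero_mul,
      sub_zero]

theorem exteriorAlgebra_cancellation
    {V : Type*} [AddCommGroup V] [Module ℝ V]
    (hV : ¬ FiniteDimensional ℝ V)
    (x : ExteriorAlgebra ℝ V)
    (h : ∀ v : V, x * ExteriorAlgebra.ι ℝ v = 0) :
    x = 0 := by
  obtain ⟨W, hW, hx⟩ := CliffordAlgebra.exists_fg_forall_contractRight_eq_zero x
  have hW_top : W ≠ ⊤ := by
    rintro rfl
    exact hV ⟨hW⟩
  obtain ⟨v, -, hv⟩ := SetLike.exists_of_lt hW_top.lt_top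
  obtain ⟨d, hdv, hdW⟩ := Submodule.exists_dual_map_eq_bot_of_notMem hv inferInstance
  have hd : ∀ w ∈ W, d w = 0 := fun w hw => by
    have hmem := Submodule.mem_map_of_mem (f := d) hw
    rwa [hdW, Submodule.mem_bot] at hmem
  have key := CliffordAlgebra.contractRight_mul_ι d v x
  rw [hx d hd, zero_mul, sub_zero] at key
  have hxv : x * CliffordAlgebra.ι 0 v = 0 := h v
  rw [hxv, map_zero, LinearMap.zero_apply] at key
  exact (smul_eq_zero.mp key.symm).resolve_left hdv
end

section
/- Decomposition of the k-Fourier mode of the Clifford–Heisenberg group for n = 2: let k ∈ ℝ, k ≠ 0. On ℂ⁴ with coordinates (ψ₀, ψ₁, ψ₂, ψ₃), define the linear maps T₁(ψ₀,ψ₁,ψ₂,ψ₃) = (−ψ₁, −(ik/2)·ψ₀, −ψ₃, −(ik/2)·ψ₂) and T₂(ψ₀,ψ₁,ψ₂,ψ₃) = (−ψ₂, ψ₃, −(ik/2)·ψ₀, (ik/2)·ψ₁), the even subspace E = {(ψ₀,0,0,ψ₃)} and the odd subspace O = {(0,ψ₁,ψ₂,0)}, and for ε ∈ {+1,−1} the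 subspace V_ε := span{(1,0,0,−εk/2), (0,1,εi,0)}. Then: (a) ℂ⁴ = V₊ ⊕ V₋ (internal direct sum); (b) each V_ε is invariant under both T₁ and T₂; and (c) the only graded subspaces W of ℂ⁴ (i.e. subspaces with W = (W ∩ E) ⊕ (W ∩ O)) that are invariant under both T₁ and T₂ are {0}, V₊, V₋ and ℂ⁴. -/
/-!
Statement 15: decomposition of the `k`-Fourier mode of the Clifford–Heisenberg group
for `n = 2` (`k ≠ 0`): `ℂ⁴ = V₊ ⊕ V₋`, each `V_ε` is invariant under `T₁` and `T₂`,
and `{0}`, `V₊`, `V₋`, `ℂ⁴` are the only graded invariant subspaces.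
-/

noncomputable section

/-- `T₁ (ψ₀,ψ₁,ψ₂,ψ₃) = (−ψ₁, −(ik/2)ψ₀, −ψ₃, −(ik/2)ψ₂)`. -/
def T1 (k : ℝ) : (Fin 4 → ℂ) →ₗ[ℂ] (Fin 4 → ℂ) :=
  Matrix.mulVecLin
    !![0, -1, 0, 0;
       -(Complex.I * (k : ℂ) / 2), 0, 0, 0;
       0, 0, 0, -1;
       0, 0, -(Complex.I * (k : ℂ) / 2), 0]

/-- `T₂ (ψ₀,ψ₁,ψ₂,ψ₃) = (−ψ₂, ψ₃, −(ik/2)ψ₀, (ik/2)ψ₁)`. -/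
def T2 (k : ℝ) : (Fin 4 → ℂ) →ₗ[ℂ] (Fin 4 → ℂ) :=
  Matrix.mulVecLin
    !![0, 0, -1, 0;
       0, 0, 0, 1;
       -(Complex.I * (k : ℂ) / 2), 0, 0, 0;
       0, Complex.I * (k : ℂ) / 2, 0, 0]

/-- The even subspace `E = {(ψ₀,0,0,ψ₃)}`. -/
def Esub : Submodule ℂ (Fin 4 → ℂ) :=
  Submodule.span ℂ {(Pi.single 0 1 : Fin 4 → ℂ), (Pi.single 3 1 : Fin 4 → ℂ)}

/-- The odd subspace `O = {(0,ψ₁,ψ₂,0)}`. -/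
def Osub : Submodule ℂ (Fin 4 → ℂ) :=
  Submodule.span ℂ {(Pi.single 1 1 : Fin 4 → ℂ), (Pi.single 2 1 : Fin 4 → ℂ)}

/-- `V_ε = span{(1,0,0,−εk/2), (0,1,εi,0)}`. -/
def Vsp (k ε : ℝ) : Submodule ℂ (Fin 4 → ℂ) :=
  Submodule.span ℂ
    {![1, 0, 0, -((ε : ℂ) * (k : ℂ)) / 2], ![0, 1, (ε : ℂ) * Complex.I, 0]}

theorem T1_apply (k : ℝ) (v : Fin 4 → ℂ) :
    T1 k v = ![-v 1, -(Complex.I * k / 2) * v 0, -v 3, -(Complex.I * k / 2) * v 2] := by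
  ext i
  fin_cases i <;> simp [T1, Matrix.mulVec, dotProduct, Fin.sum_univ_four]

theorem T2_apply (k : ℝ) (v : Fin 4 → ℂ) :
    T2 k v = ![-v 2, v 3, -(Complex.I * k / 2) * v 0, Complex.I * k / 2 * v 1] := by
  ext i
  fin_cases i <;> simp [T2, Matrix.mulVec, dotProduct, Fin.sum_univ_four]

theorem mem_Vsp_iff {k ε : ℝ} {v : Fin 4 → ℂ} :
    v ∈ Vsp k ε ↔ v 3 = -(ε * k) / 2 * v 0 ∧ v 2 = ε * Complex.I * v 1 := by
  rw [Vsp, Submodule.mem_span_pair]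
  constructor
  · rintro ⟨a, b, rfl⟩
    simp [mul_comm]
  · rintro ⟨h3, h2⟩
    refine ⟨v 0, v 1, ?_⟩
    ext i
    fin_cases i <;> simp [h3, h2, mul_comm]

theorem mem_Esub {v : Fin 4 → ℂ} (h : v ∈ Esub) : v 1 = 0 ∧ v 2 = 0 := by
  rw [Esub, Submodule.mem_span_pair] at h
  obtain ⟨a, b, rfl⟩ := h
  simp

theorem mem_Osub {v : Fin 4 → ℂ} (h : v ∈ Osub) : v 0 = 0 ∧ v 3 = 0 := by
  rw [Osub, Submodule.mem_span_pair] at h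
  obtain ⟨a, b, rfl⟩ := h
  simp

/-- A graded subspace contains the even and odd parts of each of its vectors. -/
theorem parts_mem_of_graded {W : Submodule ℂ (Fin 4 → ℂ)}
    (hW : W = (W ⊓ Esub) ⊔ (W ⊓ Osub)) {v : Fin 4 → ℂ} (hv : v ∈ W) :
    ![v 0, 0, 0, v 3] ∈ W ∧ ![0, v 1, v 2, 0] ∈ W := by
  rw [hW, Submodule.mem_sup] at hv
  obtain ⟨x, ⟨hx, hxE⟩, y, ⟨hy, hyO⟩, rfl⟩ := hv
  obtain ⟨hx1, hx2⟩ := mem_Esub hxE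
  obtain ⟨hy0, hy3⟩ := mem_Osub hyO
  constructor
  · convert SetLike.mem_coe.1 hx using 1
    ext i
    fin_cases i <;> simp [hx1, hx2, hy0, hy3]
  · convert SetLike.mem_coe.1 hy using 1
    ext i
    fin_cases i <;> simp [hx1, hx2, hy0, hy3]

theorem map_mem_Vsp {k ε : ℝ} (hε : ε ^ 2 = 1) {v : Fin 4 → ℂ} (hv : v ∈ Vsp k ε) :
    T1 k v ∈ Vsp k ε ∧ T2 k v ∈ Vsp k ε := by
  have hε' : (ε : ℂ) ^ 2 = 1 := mod_cast hε
  have hI := Complex.I_sq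
  obtain ⟨h3, h2⟩ := mem_Vsp_iff.1 hv
  simp only [mem_Vsp_iff, T1_apply, T2_apply, Matrix.cons_val, h3, h2]
  refine ⟨⟨?_, ?_⟩, ?_, ?_⟩ <;> grind

theorem isCompl_Vsp {k : ℝ} (hk : k ≠ 0) : IsCompl (Vsp k 1) (Vsp k (-1)) := by
  have hk' : (k : ℂ) ≠ 0 := mod_cast hk
  have hI := Complex.I_sq
  constructor
  · rw [Submodule.disjoint_def]
    intro v hp hm
    obtain ⟨p3, p2⟩ := mem_Vsp_iff.1 hp
    obtain ⟨m3, m2⟩ := mem_Vsp_iff.1 hm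
    push_cast at p3 p2 m3 m2
    have h0 : v 0 = 0 := by grind
    have h1 : v 1 = 0 := by grind
    ext i
    fin_cases i <;> simp [h0, h1, p3, p2]
  · rw [codisjoint_iff, eq_top_iff]
    intro v _
    rw [Submodule.mem_sup]
    refine ⟨![(v 0 - 2 * v 3 / k) / 2, (v 1 - Complex.I * v 2) / 2,
        (v 2 + Complex.I * v 1) / 2, (v 3 - k * v 0 / 2) / 2], ?_,
      ![(v 0 + 2 * v 3 / k) / 2, (v 1 + Complex.I * v 2) / 2,
        (v 2 - Complex.I * v 1) / 2, (v 3 + k * v 0 / 2) / 2], ?_, ?_⟩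
    · simp only [mem_Vsp_iff, Matrix.cons_val]
      push_cast
      constructor <;> grind
    · simp only [mem_Vsp_iff, Matrix.cons_val]
      push_cast
      constructor <;> grind
    · ext i
      fin_cases i <;> simp <;> ring

/-- An invariant subspace containing an even vector outside `V₋ε` contains `Vε`. -/
theorem Vsp_le_of_even_mem {k ε : ℝ} (hk : k ≠ 0) (hε : ε ^ 2 = 1)
    {W : Submodule ℂ (Fin 4 → ℂ)} (h1 : ∀ v ∈ W, T1 k v ∈ W) (h2 : ∀ v ∈ W, T2 k v ∈ W)
    {a d : ℂ} (hv : ![a, 0, 0, d] ∈ W) (hne : d ≠ ε * k / 2 * a) : Vsp k ε ≤ W := by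
  have hk' : (k : ℂ) ≠ 0 := mod_cast hk
  have hε' : (ε : ℂ) ^ 2 = 1 := mod_cast hε
  have hI := Complex.I_sq
  have hc : a - 2 * ε / k * d ≠ 0 := by
    intro h
    apply hne
    field_simp at h
    grind
  have he : ![1, 0, 0, -((ε : ℂ) * (k : ℂ)) / 2] ∈ W := by
    have h := W.smul_mem (a - 2 * ε / k * d)⁻¹
      (W.add_mem hv (W.smul_mem (2 * ε / k : ℂ) (h1 _ (h2 _ hv))))
    convert h using 1
    rw [eq_inv_smul_iff₀ hc, T2_apply, T1_apply]
    ext i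
    fin_cases i <;> simp <;> grind
  have hf : ![0, 1, (ε : ℂ) * Complex.I, 0] ∈ W := by
    have h := W.smul_mem (2 * Complex.I / k) (h1 _ he)
    convert h using 1
    rw [T1_apply]
    ext i
    fin_cases i <;> simp <;> grind
  rw [Vsp, Submodule.span_le]
  rintro x (rfl | rfl)
  exacts [he, hf]

theorem Vsp_le_or_le_Vsp_neg {k ε : ℝ} (hk : k ≠ 0) (hε : ε ^ 2 = 1)
    {W : Submodule ℂ (Fin 4 → ℂ)} (hW : W = (W ⊓ Esub) ⊔ (W ⊓ Osub))
    (h1 : ∀ v ∈ W, T1 k v ∈ W) (h2 : ∀ v ∈ W, T2 k v ∈ W) :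
    Vsp k ε ≤ W ∨ W ≤ Vsp k (-ε) := by
  have hk' : (k : ℂ) ≠ 0 := mod_cast hk
  have hI := Complex.I_sq
  by_contra! h
  obtain ⟨hV, hWV⟩ := h
  refine hWV fun v hv => mem_Vsp_iff.2 ?_
  obtain ⟨hE, hO⟩ := parts_mem_of_graded hW hv
  push_cast
  constructor
  · by_contra hne
    exact hV (Vsp_le_of_even_mem hk hε h1 h2 hE (by simpa using hne))
  · by_contra hne
    have hT := h1 _ hO
    simp only [T1_apply, Matrix.cons_val, mul_zero, neg_zero] at hT
    refine hV (Vsp_le_of_even_mem hk hε h1 h2 hT fun h => hne ?_)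
    grind

theorem kFourierMode_decomposition (k : ℝ) (hk : k ≠ 0) :
    -- (a) `ℂ⁴ = V₊ ⊕ V₋`
    IsCompl (Vsp k 1) (Vsp k (-1)) ∧
    -- (b) each `V_ε` is invariant under `T₁` and `T₂`
    (∀ ε : ℝ, ε = 1 ∨ ε = -1 →
      ∀ v ∈ Vsp k ε, T1 k v ∈ Vsp k ε ∧ T2 k v ∈ Vsp k ε) ∧
    -- (c) the only graded subspaces invariant under both `T₁` and `T₂` are
    --     `{0}`, `V₊`, `V₋` and `ℂ⁴`
    (∀ W : Submodule ℂ (Fin 4 → ℂ),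
      W = (W ⊓ Esub) ⊔ (W ⊓ Osub) →
      (∀ v ∈ W, T1 k v ∈ W) → (∀ v ∈ W, T2 k v ∈ W) →
      W = ⊥ ∨ W = Vsp k 1 ∨ W = Vsp k (-1) ∨ W = ⊤) := by
  refine ⟨isCompl_Vsp hk, ?_, fun W hW h1 h2 => ?_⟩
  · rintro ε (rfl | rfl) v hv
    · exact map_mem_Vsp (by norm_num) hv
    · exact map_mem_Vsp (by norm_num) hv
  · have hp := Vsp_le_or_le_Vsp_neg (ε := 1) hk (by norm_num) hW h1 h2
    have hm := Vsp_le_or_le_Vsp_neg (ε := -1) hk (by norm_num) hW h1 h2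
    rw [neg_neg] at hm
    rcases hp with hp | hp <;> rcases hm with hm | hm
    · exact .inr (.inr (.inr (top_le_iff.1 ((isCompl_Vsp hk).sup_eq_top ▸ sup_le hp hm))))
    · exact .inr (.inl (le_antisymm hm hp))
    · exact .inr (.inr (.inl (le_antisymm hp hm)))
    · exact .inl (le_bot_iff.1 ((isCompl_Vsp hk).inf_eq_bot ▸ le_inf hm hp))

end
end
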